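/- arXiv:1303.5818 — 16 statements merged into one kernel-verified Lean document; each statement's English description precedes it below -/
import Mathlib

section
/- Let X and Y be complex Banach spaces, A : X → Y and B, C : Y → X bounded linear operators satisfying ABA = ACA. Then the range of AC − I (an operator on Y) is closed if and only if the range of BA − I (an operator on X) is closed. -/
/-- If `ABA = ACA`, then the range of `BA - 1` is the preimage under `A` of the range of
`AC - 1`. -/
theorem mem_range_comp_sub_one_iff {R X Y : Type*} [Ring R] [AddCommGroup X] [Module R X]
    [AddCommGroup Y] [Module R Y] (A : X →ₗ[R] Y) (B C : Y →ₗ[R] X)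
    (h : ∀ x, A (B (A x)) = A (C (A x))) (x : X) :
    (∃ u, B (A u) - u = x) ↔ ∃ y, A (C y) - y = A x := by
  constructor
  · rintro ⟨u, rfl⟩
    exact ⟨A u, by rw [map_sub, h]⟩
  · rintro ⟨y, hy⟩
    have hz : A (C y - x) = y := by rw [map_sub, ← hy, sub_sub_cancel]
    have hw : A (B y) = A (C y) := by simpa only [hz] using h (C y - x)
    have hBy : A (B y - C y) = 0 := by rw [map_sub, hw, sub_self]
    refine ⟨B y - x, ?_⟩
    have hBx : A (B y - x) = y := by
      rw [← hz, ← sub_eq_zero, ← map_sub, hz, sub_sub_sub_cancel_right, hBy]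
    rw [hBx, sub_sub_cancel]

theorem isClosed_range_comp_sub_one {X Y : Type*} [NormedAddCommGroup X] [NormedSpace ℂ X]
    [NormedAddCommGroup Y] [NormedSpace ℂ Y] (A : X →L[ℂ] Y) (B C : Y →L[ℂ] X)
    (h : A ∘L B ∘L A = A ∘L C ∘L A)
    (hAC : IsClosed
      ((LinearMap.range ((A ∘L C - 1 : Y →L[ℂ] Y) : Y →ₗ[ℂ] Y) : Submodule ℂ Y) : Set Y)) :
    IsClosed
      ((LinearMap.range ((B ∘L A - 1 : X →L[ℂ] X) : X →ₗ[ℂ] X) : Submodule ℂ X) : Set X) := by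
  convert hAC.preimage A.continuous using 1
  ext x
  exact mem_range_comp_sub_one_iff (A : X →ₗ[ℂ] Y) (B : Y →ₗ[ℂ] X) (C : Y →ₗ[ℂ] X)
    (fun x => DFunLike.congr_fun h x) x

theorem stmt_0
    (X Y : Type*) [NormedAddCommGroup X] [NormedSpace ℂ X] [CompleteSpace X]
    [NormedAddCommGroup Y] [NormedSpace ℂ Y] [CompleteSpace Y]
    (A : X →L[ℂ] Y) (B C : Y →L[ℂ] X)
    (h : A ∘L B ∘L A = A ∘L C ∘L A) :
    IsClosed ((LinearMap.range ((A ∘L C - 1 : Y →L[ℂ] Y) : Y →ₗ[ℂ] Y) : Submodule ℂ Y) : Set Y) ↔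
      IsClosed ((LinearMap.range ((B ∘L A - 1 : X →L[ℂ] X) : X →ₗ[ℂ] X) : Submodule ℂ X) : Set X) := by
  refine ⟨isClosed_range_comp_sub_one A B C h, fun hBA => ?_⟩
  have hAB := isClosed_range_comp_sub_one B A A rfl hBA
  have hCA := isClosed_range_comp_sub_one A C B h.symm hAB
  exact isClosed_range_comp_sub_one C A A rfl hCA
end

section
/- Let X and Y be complex Banach spaces, A : X → Y and B, C : Y → X bounded linear operators satisfying ABA = ACA. Then for every natural number n, the range of (AC − I)^n is closed if and only if the range of (BA − I)^n is closed. -/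
theorem mem_range_pow_of_one_add_sq_mem {E : Type*} [NormedAddCommGroup E] [NormedSpace ℂ E]
    (S : E →L[ℂ] E) (n : ℕ) {y z : E} (hy : ((1 + S) ^ 2 : E →L[ℂ] E) y = (S ^ n) z) :
    ∃ w, (S ^ n) w = y := by
  have hco : IsCoprime ((Polynomial.X : Polynomial ℂ) ^ n) ((1 + Polynomial.X) ^ 2) :=
    IsCoprime.pow ⟨-1, 1, by ring⟩
  obtain ⟨a, b, hab⟩ := hco
  have hS : S ^ n * Polynomial.aeval S a + Polynomial.aeval S b * (1 + S) ^ 2 = 1 := by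
    rw [mul_comm a] at hab
    simpa using congrArg (Polynomial.aeval S) hab
  have hb : Polynomial.aeval S b * S ^ n = S ^ n * Polynomial.aeval S b := by
    simpa using congrArg (Polynomial.aeval S) (mul_comm b (Polynomial.X ^ n))
  refine ⟨Polynomial.aeval S a y + Polynomial.aeval S b z, ?_⟩
  have hSy := DFunLike.congr_fun hS y
  have hbz := DFunLike.congr_fun hb z
  simp only [add_apply, mul_apply_eq_comp,
    one_apply_eq_self] at hSy hbz
  rw [map_add, ← hbz, ← hy, hSy]

theorem comp_pow_eq_pow_comp {E F : Type*} [NormedAddCommGroup E] [NormedSpace ℂ E]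
    [NormedAddCommGroup F] [NormedSpace ℂ F] {S : E →L[ℂ] E} {T : F →L[ℂ] F} {U : E →L[ℂ] F}
    (hU : ∀ x, U (S x) = T (U x)) (n : ℕ) (x : E) : U ((S ^ n) x) = (T ^ n) (U x) := by
  induction n generalizing x with
  | zero => simp
  | succ k ih => simp only [pow_succ, mul_apply_eq_comp, ih, hU]

theorem isClosed_range_pow_of_intertwining {E F : Type*} [NormedAddCommGroup E] [NormedSpace ℂ E]
    [NormedAddCommGroup F] [NormedSpace ℂ F] {S : E →L[ℂ] E} {T : F →L[ℂ] F}
    {U : E →L[ℂ] F} {V : F →L[ℂ] E}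
    (hU : ∀ x, U (S x) = T (U x)) (hV : ∀ x, V (T x) = S (V x))
    (hVU : ∀ x, V (U x) = ((1 + S) ^ 2 : E →L[ℂ] E) x) (n : ℕ)
    (hT : IsClosed ((LinearMap.range ((T ^ n : F →L[ℂ] F) : F →ₗ[ℂ] F) : Submodule ℂ F) : Set F)) :
    IsClosed ((LinearMap.range ((S ^ n : E →L[ℂ] E) : E →ₗ[ℂ] E) : Submodule ℂ E) : Set E) := by
  convert hT.preimage U.continuous using 1
  ext y
  constructor
  · rintro ⟨z, rfl⟩
    exact ⟨U z, (comp_pow_eq_pow_comp hU n z).symm⟩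
  · rintro ⟨x, hx⟩
    refine mem_range_pow_of_one_add_sq_mem S n (z := V x) ?_
    rw [← hVU, ← comp_pow_eq_pow_comp hV]
    exact congrArg V hx.symm

theorem stmt_1
    (X Y : Type*) [NormedAddCommGroup X] [NormedSpace ℂ X] [CompleteSpace X]
    [NormedAddCommGroup Y] [NormedSpace ℂ Y] [CompleteSpace Y]
    (A : X →L[ℂ] Y) (B C : Y →L[ℂ] X)
    (h : A ∘L B ∘L A = A ∘L C ∘L A) (n : ℕ) :
    IsClosed ((LinearMap.range (((A ∘L C - 1) ^ n : Y →L[ℂ] Y) : Y →ₗ[ℂ] Y) : Submodule ℂ Y) : Set Y) ↔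
      IsClosed ((LinearMap.range (((B ∘L A - 1) ^ n : X →L[ℂ] X) : X →ₗ[ℂ] X) : Submodule ℂ X) : Set X) := by
  have hA : ∀ x, A (B (A x)) = A (C (A x)) := fun x => DFunLike.congr_fun h x
  have hAST : ∀ x, A ((B ∘L A - 1) x) = (A ∘L C - 1) (A x) := fun x => by simp [hA]
  have hJTS : ∀ y, (B ∘L A ∘L C) ((A ∘L C - 1) y) = (B ∘L A - 1) ((B ∘L A ∘L C) y) :=
    fun y => by simp [hA]
  constructor
  · exact isClosed_range_pow_of_intertwining hAST hJTS (fun x => by simp [pow_two, hA]) n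
  · exact isClosed_range_pow_of_intertwining hJTS hAST (fun y => by simp [pow_two, hA]) n
end

section
/- Let X and Y be complex Banach spaces, A : X → Y and B, C : Y → X bounded linear operators satisfying ABA = ACA. Then for every natural number d, the image under A of the range of (BA − I)^d is contained in the range of (AC − I)^d. -/
theorem ContinuousLinearMap.map_pow_apply_of_intertwine {R M N : Type*} [Semiring R]
    [AddCommMonoid M] [Module R M] [TopologicalSpace M]
    [AddCommMonoid N] [Module R N] [TopologicalSpace N]
    {A : M →L[R] N} {S : M →L[R] M} {T : N →L[R] N}
    (h : ∀ x, A (S x) = T (A x)) (d : ℕ) (x : M) : A ((S ^ d) x) = (T ^ d) (A x) := by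
  induction d generalizing x with
  | zero => rfl
  | succ d ih => rw [pow_succ, pow_succ, mul_apply_eq_comp, mul_apply_eq_comp, ih, h]

theorem stmt_2
    (X Y : Type*) [NormedAddCommGroup X] [NormedSpace ℂ X] [CompleteSpace X]
    [NormedAddCommGroup Y] [NormedSpace ℂ Y] [CompleteSpace Y]
    (A : X →L[ℂ] Y) (B C : Y →L[ℂ] X)
    (h : A ∘L B ∘L A = A ∘L C ∘L A) (d : ℕ) :
    Submodule.map (A : X →ₗ[ℂ] Y) (LinearMap.range (((B ∘L A - 1) ^ d : X →L[ℂ] X) : X →ₗ[ℂ] X)) ≤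
      LinearMap.range (((A ∘L C - 1) ^ d : Y →L[ℂ] Y) : Y →ₗ[ℂ] Y) := by
  rintro _ ⟨_, ⟨x, rfl⟩, rfl⟩
  refine ⟨A x, (ContinuousLinearMap.map_pow_apply_of_intertwine (fun z => ?_) d x).symm⟩
  have hz : A (B (A z)) = A (C (A z)) := DFunLike.congr_fun h z
  simp [hz]
end

section
/- Let X and Y be complex Banach spaces, A : X → Y and B, C : Y → X bounded linear operators satisfying ABA = ACA. Then for every natural number d, the image under A of the kernel of (BA − I)^d is contained in the kernel of (AC − I)^d. -/
theorem ContinuousLinearMap.pow_apply_of_intertwines {R M N : Type*} [Semiring R]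
    [AddCommMonoid M] [TopologicalSpace M] [Module R M]
    [AddCommMonoid N] [TopologicalSpace N] [Module R N]
    {A : M →L[R] N} {S : M →L[R] M} {T : N →L[R] N}
    (h : ∀ x, T (A x) = A (S x)) (d : ℕ) (x : M) : (T ^ d) (A x) = A ((S ^ d) x) := by
  induction d generalizing x with
  | zero => simp
  | succ d ih => rw [pow_succ, pow_succ, mul_apply_eq_comp, mul_apply_eq_comp, h, ih]

theorem stmt_3
    (X Y : Type*) [NormedAddCommGroup X] [NormedSpace ℂ X] [CompleteSpace X]
    [NormedAddCommGroup Y] [NormedSpace ℂ Y] [CompleteSpace Y]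
    (A : X →L[ℂ] Y) (B C : Y →L[ℂ] X)
    (h : A ∘L B ∘L A = A ∘L C ∘L A) (d : ℕ) :
    Submodule.map (A : X →ₗ[ℂ] Y) (LinearMap.ker (((B ∘L A - 1) ^ d : X →L[ℂ] X) : X →ₗ[ℂ] X)) ≤
      LinearMap.ker (((A ∘L C - 1) ^ d : Y →L[ℂ] Y) : Y →ₗ[ℂ] Y) := by
  rintro _ ⟨x, hx, rfl⟩
  have hx' : ((B ∘L A - 1) ^ d : X →L[ℂ] X) x = 0 := hx
  have hAC : ∀ x, (A ∘L C - 1 : Y →L[ℂ] Y) (A x) = A ((B ∘L A - 1 : X →L[ℂ] X) x) := fun x => by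
    have hx : A (B (A x)) = A (C (A x)) := DFunLike.congr_fun h x
    simp [hx]
  change ((A ∘L C - 1) ^ d : Y →L[ℂ] Y) (A x) = 0
  rw [ContinuousLinearMap.pow_apply_of_intertwines hAC, hx', map_zero]
end

section
/- Let X and Y be complex Banach spaces, A : X → Y and B, C : Y → X bounded linear operators satisfying ABA = ACA. Then for every natural number d, the image under the operator BAC : Y → X of the kernel of (AC − I)^d is contained in the kernel of (BA − I)^d. -/
/-- If `ABA = ACA`, then `BAC` intertwines the powers of `AC - 1` and `BA - 1`. -/
theorem sub_one_pow_apply_of_comp_eq {𝕜 X Y : Type*} [NontriviallyNormedField 𝕜]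
    [NormedAddCommGroup X] [NormedSpace 𝕜 X] [NormedAddCommGroup Y] [NormedSpace 𝕜 Y]
    (A : X →L[𝕜] Y) (B C : Y →L[𝕜] X)
    (h : A ∘L B ∘L A = A ∘L C ∘L A) (d : ℕ) (y : Y) :
    ((B ∘L A - 1) ^ d : X →L[𝕜] X) (B (A (C y))) =
      B (A (C (((A ∘L C - 1) ^ d : Y →L[𝕜] Y) y))) := by
  induction d generalizing y with
  | zero => simp
  | succ d ih =>
    have key : (B ∘L A - 1 : X →L[𝕜] X) (B (A (C y))) =
        B (A (C ((A ∘L C - 1 : Y →L[𝕜] Y) y))) := by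
      have hy : A (B (A (C y))) = A (C (A (C y))) := DFunLike.congr_fun h (C y)
      simp [hy]
    rw [pow_succ, pow_succ, mul_apply_eq_comp, mul_apply_eq_comp, key, ih]

theorem stmt_4
    (X Y : Type*) [NormedAddCommGroup X] [NormedSpace ℂ X] [CompleteSpace X]
    [NormedAddCommGroup Y] [NormedSpace ℂ Y] [CompleteSpace Y]
    (A : X →L[ℂ] Y) (B C : Y →L[ℂ] X)
    (h : A ∘L B ∘L A = A ∘L C ∘L A) (d : ℕ) :
    Submodule.map ((B ∘L A ∘L C : Y →L[ℂ] X) : Y →ₗ[ℂ] X)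
        (LinearMap.ker (((A ∘L C - 1) ^ d : Y →L[ℂ] Y) : Y →ₗ[ℂ] Y)) ≤
      LinearMap.ker (((B ∘L A - 1) ^ d : X →L[ℂ] X) : X →ₗ[ℂ] X) := by
  rintro _ ⟨y, hy, rfl⟩
  have hy' : ((A ∘L C - 1) ^ d : Y →L[ℂ] Y) y = 0 := hy
  change ((B ∘L A - 1) ^ d : X →L[ℂ] X) (B (A (C y))) = 0
  rw [sub_one_pow_apply_of_comp_eq A B C h, hy', map_zero, map_zero, map_zero]
end

section
/- Let X and Y be complex Banach spaces, A : X → Y and B, C : Y → X bounded linear operators satisfying ABA = ACA. Then for every natural number d, the image under the operator BAC : Y → X of the range of (AC − I)^d is contained in the range of (BA − I)^d. -/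
theorem apply_pow_eq_pow_apply {𝕜 E F : Type*} [NormedField 𝕜]
    [NormedAddCommGroup E] [NormedSpace 𝕜 E] [NormedAddCommGroup F] [NormedSpace 𝕜 F]
    {T : E →L[𝕜] F} {P : E →L[𝕜] E} {Q : F →L[𝕜] F}
    (hT : ∀ y, T (P y) = Q (T y)) (d : ℕ) (y : E) :
    T ((P ^ d) y) = (Q ^ d) (T y) := by
  induction d generalizing y with
  | zero => simp
  | succ n ih =>
    rw [pow_succ, pow_succ, mul_apply_eq_comp, mul_apply_eq_comp, ih, hT]

theorem intertwine_sub_one {𝕜 E F : Type*} [NormedField 𝕜]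
    [NormedAddCommGroup E] [NormedSpace 𝕜 E] [NormedAddCommGroup F] [NormedSpace 𝕜 F]
    (A : E →L[𝕜] F) (B C : F →L[𝕜] E) (h : A ∘L B ∘L A = A ∘L C ∘L A) (y : F) :
    (B ∘L A ∘L C) ((A ∘L C - 1) y) = (B ∘L A - 1) ((B ∘L A ∘L C) y) := by
  have hy : A (B (A (C y))) = A (C (A (C y))) := DFunLike.congr_fun h (C y)
  simp [hy]

theorem stmt_5
    (X Y : Type*) [NormedAddCommGroup X] [NormedSpace ℂ X] [CompleteSpace X]
    [NormedAddCommGroup Y] [NormedSpace ℂ Y] [CompleteSpace Y]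
    (A : X →L[ℂ] Y) (B C : Y →L[ℂ] X)
    (h : A ∘L B ∘L A = A ∘L C ∘L A) (d : ℕ) :
    Submodule.map ((B ∘L A ∘L C : Y →L[ℂ] X) : Y →ₗ[ℂ] X)
        (LinearMap.range (((A ∘L C - 1) ^ d : Y →L[ℂ] Y) : Y →ₗ[ℂ] Y)) ≤
      LinearMap.range (((B ∘L A - 1) ^ d : X →L[ℂ] X) : X →ₗ[ℂ] X) := by
  rintro _ ⟨_, ⟨y, rfl⟩, rfl⟩
  exact ⟨(B ∘L A ∘L C) y, (apply_pow_eq_pow_apply (intertwine_sub_one A B C h) d y).symm⟩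
end

section
/- Let X and Y be complex Banach spaces, A : X → Y and B, C : Y → X bounded linear operators satisfying ABA = ACA. Then for every natural number d, the subspace R(AC − I) + N((AC − I)^d) of Y is closed if and only if the subspace R(BA − I) + N((BA − I)^d) of X is closed. -/
section Intertwining

variable {𝕜 V W : Type*} [NontriviallyNormedField 𝕜]
  [NormedAddCommGroup V] [NormedSpace 𝕜 V] [NormedAddCommGroup W] [NormedSpace 𝕜 W]

theorem ContinuousLinearMap.map_pow_apply_of_intertwine_s6 {S : W →L[𝕜] W} {T : V →L[𝕜] V}
    {A : V →L[𝕜] W} (hA : ∀ x, A (T x) = S (A x)) (n : ℕ) (x : V) :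
    A ((T ^ n) x) = (S ^ n) (A x) := by
  induction n generalizing x with
  | zero => simp
  | succ n ih => rw [pow_succ, pow_succ, mul_apply_eq_comp, mul_apply_eq_comp, ih, hA]

theorem ContinuousLinearMap.map_mem_range_sup_ker_pow {S : W →L[𝕜] W} {T : V →L[𝕜] V}
    {A : V →L[𝕜] W} (hA : ∀ x, A (T x) = S (A x)) (d : ℕ) {x : V}
    (hx : x ∈ LinearMap.range (T : V →ₗ[𝕜] V) ⊔ LinearMap.ker ((T ^ d : V →L[𝕜] V) : V →ₗ[𝕜] V)) :
    A x ∈ LinearMap.range (S : W →ₗ[𝕜] W) ⊔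
      LinearMap.ker ((S ^ d : W →L[𝕜] W) : W →ₗ[𝕜] W) := by
  obtain ⟨_, ⟨u, rfl⟩, v, hv, rfl⟩ := Submodule.mem_sup.1 hx
  have hv' : (T ^ d) v = 0 := hv
  refine Submodule.mem_sup.2 ⟨S (A u), ⟨A u, rfl⟩, A v, ?_, ?_⟩
  · change (S ^ d) (A v) = 0
    rw [← map_pow_apply_of_intertwine_s6 hA, hv', map_zero]
  · rw [map_add, ← hA]
    rfl

/-- If `A` and `D` intertwine `T` and `S`, and `D A` is the identity modulo the range of `T`, then
`R(T) + N(T ^ d)` is the preimage under `A` of `R(S) + N(S ^ d)`, so it inherits closedness. -/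
theorem ContinuousLinearMap.isClosed_range_sup_ker_pow_of_intertwine {S : W →L[𝕜] W}
    {T : V →L[𝕜] V} {A : V →L[𝕜] W} {D : W →L[𝕜] V} (hA : ∀ x, A (T x) = S (A x))
    (hD : ∀ y, D (S y) = T (D y)) (hDA : ∀ x, ∃ u, D (A x) = x + T u) (d : ℕ)
    (hS : IsClosed ((LinearMap.range (S : W →ₗ[𝕜] W) ⊔
      LinearMap.ker ((S ^ d : W →L[𝕜] W) : W →ₗ[𝕜] W) : Submodule 𝕜 W) : Set W)) :
    IsClosed ((LinearMap.range (T : V →ₗ[𝕜] V) ⊔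
      LinearMap.ker ((T ^ d : V →L[𝕜] V) : V →ₗ[𝕜] V) : Submodule 𝕜 V) : Set V) := by
  convert hS.preimage A.continuous using 1
  ext x
  refine ⟨map_mem_range_sup_ker_pow hA d, fun hx ↦ ?_⟩
  have hDAx := map_mem_range_sup_ker_pow hD d hx
  obtain ⟨u, hu⟩ := hDA x
  rw [hu] at hDAx
  have hTu := LinearMap.mem_range_self (T : V →ₗ[𝕜] V) u
  exact (Submodule.add_mem_iff_left _ (Submodule.mem_sup_left hTu)).1 hDAx

end Intertwining

theorem stmt_6
    (X Y : Type*) [NormedAddCommGroup X] [NormedSpace ℂ X] [CompleteSpace X]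
    [NormedAddCommGroup Y] [NormedSpace ℂ Y] [CompleteSpace Y]
    (A : X →L[ℂ] Y) (B C : Y →L[ℂ] X)
    (h : A ∘L B ∘L A = A ∘L C ∘L A) (d : ℕ) :
    IsClosed ((LinearMap.range ((A ∘L C - 1 : Y →L[ℂ] Y) : Y →ₗ[ℂ] Y) ⊔ LinearMap.ker (((A ∘L C - 1) ^ d : Y →L[ℂ] Y) : Y →ₗ[ℂ] Y) :
        Submodule ℂ Y) : Set Y) ↔
      IsClosed ((LinearMap.range ((B ∘L A - 1 : X →L[ℂ] X) : X →ₗ[ℂ] X) ⊔ LinearMap.ker (((B ∘L A - 1) ^ d : X →L[ℂ] X) : X →ₗ[ℂ] X) :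
        Submodule ℂ X) : Set X) := by
  have h' (x : X) : A (B (A x)) = A (C (A x)) := congrArg (fun f ↦ f x) h
  have hA (x : X) : A ((B ∘L A - 1) x) = (A ∘L C - 1) (A x) := by simp [h']
  have hD (y : Y) : (B ∘L A ∘L C) ((A ∘L C - 1) y) = (B ∘L A - 1) ((B ∘L A ∘L C) y) := by
    simp [h']
  constructor
  · refine ContinuousLinearMap.isClosed_range_sup_ker_pow_of_intertwine hA hD (fun x ↦ ?_) d
    exact ⟨x + B (A x), by simp [← h']; abel⟩
  · refine ContinuousLinearMap.isClosed_range_sup_ker_pow_of_intertwine hD hA (fun y ↦ ?_) d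
    exact ⟨y + A (C y), by simp [h']; abel⟩
end

section
/- Let X and Y be complex Banach spaces, A : X → Y and B, C : Y → X bounded linear operators satisfying ABA = ACA. Then for every natural number n, c'_n(AC − I) = c'_n(BA − I), where for a bounded operator T on a Banach space Z, c'_n(T) denotes the dimension (as a cardinal) of the quotient vector space N(T^{n+1}) / N(T^n). -/
section KernelQuotients

variable {R E F : Type*} [CommRing R] [AddCommGroup E] [Module R E] [AddCommGroup F] [Module R F]

/-- The quotient `N(T ^ (n + 1)) / N(T ^ n)`. -/
abbrev KerPowQuotient (T : Module.End R E) (n : ℕ) : Type _ :=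
  ↥(LinearMap.ker (T ^ (n + 1))) ⧸
    Submodule.comap (LinearMap.ker (T ^ (n + 1))).subtype (LinearMap.ker (T ^ n))

lemma pow_apply_intertwine {T : Module.End R E} {S : Module.End R F} {f : E →ₗ[R] F}
    (hf : ∀ x, f (T x) = S (f x)) (n : ℕ) (x : E) : f ((T ^ n) x) = (S ^ n) (f x) := by
  induction n generalizing x with
  | zero => simp
  | succ n ih => rw [pow_succ, pow_succ, Module.End.mul_apply, Module.End.mul_apply, ih, hf]

lemma mem_ker_pow_of_intertwine {T : Module.End R E} {S : Module.End R F} {f : E →ₗ[R] F}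
    (hf : ∀ x, f (T x) = S (f x)) (n : ℕ) {x : E} (hx : x ∈ LinearMap.ker (T ^ n)) :
    f x ∈ LinearMap.ker (S ^ n) := by
  rw [LinearMap.mem_ker] at hx ⊢
  rw [← pow_apply_intertwine hf, hx, map_zero]

/-- A linear map intertwining `T` and `S` induces a map between the quotients of kernels. -/
def kerPowQuotientMap {T : Module.End R E} {S : Module.End R F} (f : E →ₗ[R] F)
    (hf : ∀ x, f (T x) = S (f x)) (n : ℕ) : KerPowQuotient T n →ₗ[R] KerPowQuotient S n :=
  Submodule.mapQ _ _ (f.restrict fun _ hx => mem_ker_pow_of_intertwine hf (n + 1) hx)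
    fun _ hx => mem_ker_pow_of_intertwine hf n hx

lemma kerPowQuotientMap_comp_eq_id {T : Module.End R E} {S : Module.End R F}
    {f : E →ₗ[R] F} {g : F →ₗ[R] E}
    (hf : ∀ x, f (T x) = S (f x)) (hg : ∀ y, g (S y) = T (g y))
    (hgf : ∀ x, g (f x) = x + (2 : R) • T x + T (T x)) (n : ℕ) :
    kerPowQuotientMap g hg n ∘ₗ kerPowQuotientMap f hf n = LinearMap.id := by
  refine Submodule.linearMap_qext _ (LinearMap.ext fun ⟨x, hx₀⟩ => ?_)
  refine (Submodule.Quotient.eq _).2 ?_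
  have hx : (T ^ n) (T x) = 0 := by
    rwa [LinearMap.mem_ker, pow_succ, Module.End.mul_apply] at hx₀
  have hx' : (T ^ n) (T (T x)) = 0 := by
    rw [← Module.End.mul_apply, ← pow_succ, pow_succ', Module.End.mul_apply, hx, map_zero]
  change (T ^ n) (g (f x) - x) = 0
  rw [hgf]
  simp [hx, hx']

/-- Two endomorphisms intertwined by maps whose composites are `(1 + T) ^ 2` and `(1 + S) ^ 2`
have isomorphic quotients of consecutive kernels. -/
def kerPowQuotientEquiv {T : Module.End R E} {S : Module.End R F}
    (f : E →ₗ[R] F) (g : F →ₗ[R] E)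
    (hf : ∀ x, f (T x) = S (f x)) (hg : ∀ y, g (S y) = T (g y))
    (hgf : ∀ x, g (f x) = x + (2 : R) • T x + T (T x))
    (hfg : ∀ y, f (g y) = y + (2 : R) • S y + S (S y)) (n : ℕ) :
    KerPowQuotient T n ≃ₗ[R] KerPowQuotient S n :=
  LinearEquiv.ofLinearMap (kerPowQuotientMap f hf n) (kerPowQuotientMap g hg n)
    (kerPowQuotientMap_comp_eq_id hg hf hfg n) (kerPowQuotientMap_comp_eq_id hf hg hgf n)

end KernelQuotients

universe u v

theorem stmt_7
    (X : Type u) (Y : Type v)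
    [NormedAddCommGroup X] [NormedSpace ℂ X] [CompleteSpace X]
    [NormedAddCommGroup Y] [NormedSpace ℂ Y] [CompleteSpace Y]
    (A : X →L[ℂ] Y) (B C : Y →L[ℂ] X)
    (h : A ∘L B ∘L A = A ∘L C ∘L A) (n : ℕ) :
    Cardinal.lift.{u} (Module.rank ℂ
        (↥(LinearMap.ker ((A ∘L C - 1) ^ (n + 1) : Y →L[ℂ] Y).toLinearMap) ⧸
          Submodule.comap (LinearMap.ker ((A ∘L C - 1) ^ (n + 1) : Y →L[ℂ] Y).toLinearMap).subtype
            (LinearMap.ker ((A ∘L C - 1) ^ n : Y →L[ℂ] Y).toLinearMap))) =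
      Cardinal.lift.{v} (Module.rank ℂ
        (↥(LinearMap.ker ((B ∘L A - 1) ^ (n + 1) : X →L[ℂ] X).toLinearMap) ⧸
          Submodule.comap (LinearMap.ker ((B ∘L A - 1) ^ (n + 1) : X →L[ℂ] X).toLinearMap).subtype
            (LinearMap.ker ((B ∘L A - 1) ^ n : X →L[ℂ] X).toLinearMap))) := by
  have h' (x : X) : A (B (A x)) = A (C (A x)) := congrArg (fun f => f x) h
  rw [ContinuousLinearMap.toLinearMap_pow, ContinuousLinearMap.toLinearMap_pow,
    ContinuousLinearMap.toLinearMap_pow, ContinuousLinearMap.toLinearMap_pow]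
  refine (LinearEquiv.lift_rank_eq (kerPowQuotientEquiv A.toLinearMap
    (B ∘L A ∘L C).toLinearMap ?_ ?_ ?_ ?_ n)).symm
  · intro x
    simp [h']
  · intro y
    simp [h']
  · intro x
    simp [← h', two_smul]
    abel
  · intro y
    simp [h', two_smul]
    abel
end

section
/- Let X and Y be complex Banach spaces, A : X → Y and B, C : Y → X bounded linear operators satisfying ABA = ACA. Then the dimension (as a cardinal) of the hyper-kernel N((AC − I)^∞) = ⋃_{n≥0} N((AC − I)^n) equals the dimension of the hyper-kernel N((BA − I)^∞) = ⋃_{n≥0} N((BA − I)^n). -/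
universe u v

namespace LinearMap

variable {R M N : Type*} [CommRing R] [AddCommGroup M] [Module R M] [AddCommGroup N] [Module R N]

theorem ker_sub_one_pow_le_succ (S : Module.End R N) (n : ℕ) :
    ker ((S - 1) ^ n) ≤ ker ((S - 1) ^ (n + 1)) := by
  intro y hy
  simp_all [pow_succ', Module.End.mul_apply]

theorem exists_mem_ker_sub_one_pow_apply_eq (S : Module.End R N) (n : ℕ) {y : N}
    (hy : y ∈ ker ((S - 1) ^ n)) : ∃ q ∈ ker ((S - 1) ^ n), S q = y := by
  induction n generalizing y with
  | zero => exact ⟨0, by simp, by simpa using hy.symm⟩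
  | succ n ih =>
    obtain ⟨q, hq, hSq⟩ := ih (y := (S - 1) y) (by
      rwa [mem_ker, pow_succ, Module.End.mul_apply] at hy)
    refine ⟨y - q, sub_mem hy (ker_sub_one_pow_le_succ S n hq), ?_⟩
    rw [map_sub, hSq]
    simp

theorem eq_zero_of_mem_ker_sub_one_pow (T : Module.End R M) (n : ℕ) {x : M}
    (hx : x ∈ ker ((T - 1) ^ n)) (hTx : T x = 0) : x = 0 := by
  induction n with
  | zero => simpa using hx
  | succ n ih =>
    apply ih
    simpa [pow_succ, Module.End.mul_apply, hTx] using hx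

theorem comp_sub_one_pow_apply {A : M →ₗ[R] N} {S : Module.End R N} {T : Module.End R M}
    (hA : ∀ x, A (T x) = S (A x)) (n : ℕ) (x : M) :
    A (((T - 1) ^ n) x) = ((S - 1) ^ n) (A x) := by
  induction n generalizing x with
  | zero => simp
  | succ n ih => simp [pow_succ, Module.End.mul_apply, ih, hA]

theorem map_ker_sub_one_pow {A : M →ₗ[R] N} {B C : N →ₗ[R] M}
    (h : ∀ x, A (B (A x)) = A (C (A x))) (n : ℕ) :
    (ker ((B ∘ₗ A - 1 : Module.End R M) ^ n)).map A =
      ker ((A ∘ₗ C - 1 : Module.End R N) ^ n) := by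
  set T : Module.End R M := B ∘ₗ A with hT
  set S : Module.End R N := A ∘ₗ C with hS
  have hA : ∀ x, A (T x) = S (A x) := h
  apply le_antisymm
  · rintro _ ⟨x, hx, rfl⟩
    rw [mem_ker, ← comp_sub_one_pow_apply hA, mem_ker.1 hx, map_zero]
  · intro y hy
    obtain ⟨q, hq, rfl⟩ := exists_mem_ker_sub_one_pow_apply_eq S n hy
    obtain ⟨r, -, rfl⟩ := exists_mem_ker_sub_one_pow_apply_eq S n hq
    refine ⟨T (C r), ?_, hA (C r)⟩
    have hcomm : Commute ((T - 1) ^ n) T :=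
      ((Commute.refl T).sub_left (Commute.one_left T)).pow_left n
    have hz : A (((T - 1) ^ n) (C r)) = 0 := by
      rw [comp_sub_one_pow_apply hA]
      exact hq
    change ((T - 1) ^ n * T) (C r) = 0
    rw [hcomm.eq, Module.End.mul_apply, hT, comp_apply, ← hT, hz, map_zero]

theorem lift_rank_iSup_ker_sub_one_pow_eq {M : Type u} {N : Type v} [AddCommGroup M] [Module R M]
    [AddCommGroup N] [Module R N] {A : M →ₗ[R] N} {B C : N →ₗ[R] M}
    (h : ∀ x, A (B (A x)) = A (C (A x))) :
    Cardinal.lift.{u} (Module.rank R ↥(⨆ n : ℕ, ker ((A ∘ₗ C - 1 : Module.End R N) ^ n))) =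
      Cardinal.lift.{v}
        (Module.rank R ↥(⨆ n : ℕ, ker ((B ∘ₗ A - 1 : Module.End R M) ^ n))) := by
  rw [← iSup_congr (map_ker_sub_one_pow h), ← Submodule.map_iSup]
  set p := ⨆ n : ℕ, ker ((B ∘ₗ A - 1 : Module.End R M) ^ n)
  refine (LinearEquiv.ofBijective (A.submoduleMap p)
    ⟨?_, A.submoduleMap_surjective p⟩).lift_rank_eq.symm
  rw [injective_iff_map_eq_zero]
  rintro ⟨x, hx⟩ hAx
  obtain ⟨n, hn⟩ := (Submodule.mem_iSup_of_directed _
    (monotone_nat_of_le_succ (ker_sub_one_pow_le_succ (B ∘ₗ A))).directed_le).1 hx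
  have hAx : A x = 0 := congrArg Subtype.val hAx
  exact Subtype.ext (eq_zero_of_mem_ker_sub_one_pow _ n hn (by simp [hAx]))

end LinearMap

theorem stmt_8
    (X : Type u) (Y : Type v)
    [NormedAddCommGroup X] [NormedSpace ℂ X] [CompleteSpace X]
    [NormedAddCommGroup Y] [NormedSpace ℂ Y] [CompleteSpace Y]
    (A : X →L[ℂ] Y) (B C : Y →L[ℂ] X)
    (h : A ∘L B ∘L A = A ∘L C ∘L A) :
    Cardinal.lift.{u} (Module.rank ℂ ↥(⨆ n : ℕ, LinearMap.ker (((A ∘L C - 1) ^ n : Y →L[ℂ] Y) : Y →ₗ[ℂ] Y))) =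
      Cardinal.lift.{v} (Module.rank ℂ ↥(⨆ n : ℕ, LinearMap.ker (((B ∘L A - 1) ^ n : X →L[ℂ] X) : X →ₗ[ℂ] X))) := by
  have hY (n : ℕ) : (((A ∘L C - 1) ^ n : Y →L[ℂ] Y) : Y →ₗ[ℂ] Y) =
      ((A : X →ₗ[ℂ] Y) ∘ₗ (C : Y →ₗ[ℂ] X) - 1 : Module.End ℂ Y) ^ n :=
    map_pow (ContinuousLinearMap.toLinearMapRingHom (R₁ := ℂ) (M₁ := Y)) (A ∘L C - 1) n
  have hX (n : ℕ) : (((B ∘L A - 1) ^ n : X →L[ℂ] X) : X →ₗ[ℂ] X) =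
      ((B : Y →ₗ[ℂ] X) ∘ₗ (A : X →ₗ[ℂ] Y) - 1 : Module.End ℂ X) ^ n :=
    map_pow (ContinuousLinearMap.toLinearMapRingHom (R₁ := ℂ) (M₁ := X)) (B ∘L A - 1) n
  rw [iSup_congr fun n => congrArg LinearMap.ker (hY n),
    iSup_congr fun n => congrArg LinearMap.ker (hX n)]
  exact LinearMap.lift_rank_iSup_ker_sub_one_pow_eq fun x => DFunLike.congr_fun h x
end

section
/- Let X and Y be complex Banach spaces, A : X → Y and B, C : Y → X bounded linear operators satisfying ABA = ACA. Then for every natural number n, the dimension (as a cardinal) of the quotient vector space Y / (R(AC − I) + N((AC − I)^n)) equals the dimension of the quotient vector space X / (R(BA − I) + N((BA − I)^n)); equivalently, c_n(AC − I) = c_n(BA − I), where c_n(T) = dim R(T^n)/R(T^{n+1}). -/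
universe u v

/-- An intertwining map sends `range f ⊔ ker (f ^ n)` into `range g ⊔ ker (g ^ n)`. -/
theorem range_sup_ker_pow_le_comap {R M N : Type*} [Ring R] [AddCommGroup M] [Module R M]
    [AddCommGroup N] [Module R N] {f : Module.End R M} {g : Module.End R N} {a : M →ₗ[R] N}
    (h : ∀ x, a (f x) = g (a x)) (n : ℕ) :
    LinearMap.range f ⊔ LinearMap.ker (f ^ n) ≤
      (LinearMap.range g ⊔ LinearMap.ker (g ^ n)).comap a := by
  have hpow (x : M) : a ((f ^ n) x) = (g ^ n) (a x) := by
    simp only [Module.End.pow_apply]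
    exact Function.Semiconj.iterate_right h n x
  refine sup_le ?_ fun x hx => ?_
  · rintro _ ⟨x, rfl⟩
    exact Submodule.mem_sup_left ⟨a x, (h x).symm⟩
  · refine Submodule.mem_sup_right ?_
    rw [LinearMap.mem_ker] at hx ⊢
    rw [← hpow, hx, map_zero]

/-- Two endomorphisms intertwined by maps that are mutually inverse modulo their ranges have
isomorphic quotients by `range ⊔ ker (· ^ n)`. -/
def quotientRangeSupKerPowEquiv {R M N : Type*} [Ring R] [AddCommGroup M] [Module R M]
    [AddCommGroup N] [Module R N] {f : Module.End R M} {g : Module.End R N}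
    (a : M →ₗ[R] N) (d : N →ₗ[R] M)
    (ha : ∀ x, a (f x) = g (a x)) (hd : ∀ y, d (g y) = f (d y))
    (hda : ∀ x, d (a x) - x ∈ LinearMap.range f) (had : ∀ y, a (d y) - y ∈ LinearMap.range g)
    (n : ℕ) :
    (M ⧸ (LinearMap.range f ⊔ LinearMap.ker (f ^ n))) ≃ₗ[R]
      (N ⧸ (LinearMap.range g ⊔ LinearMap.ker (g ^ n))) :=
  LinearEquiv.ofLinearMap
    (Submodule.mapQ _ _ a (range_sup_ker_pow_le_comap ha n))
    (Submodule.mapQ _ _ d (range_sup_ker_pow_le_comap hd n))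
    (by
      ext y
      exact (Submodule.Quotient.eq _).2 (Submodule.mem_sup_left (had y)))
    (by
      ext x
      exact (Submodule.Quotient.eq _).2 (Submodule.mem_sup_left (hda x)))

theorem stmt_9
    (X : Type u) (Y : Type v)
    [NormedAddCommGroup X] [NormedSpace ℂ X] [CompleteSpace X]
    [NormedAddCommGroup Y] [NormedSpace ℂ Y] [CompleteSpace Y]
    (A : X →L[ℂ] Y) (B C : Y →L[ℂ] X)
    (h : A ∘L B ∘L A = A ∘L C ∘L A) (n : ℕ) :
    Cardinal.lift.{u} (Module.rank ℂ
        (Y ⧸ (LinearMap.range ((A ∘L C - 1 : Y →L[ℂ] Y) : Y →ₗ[ℂ] Y) ⊔ LinearMap.ker (((A ∘L C - 1) ^ n : Y →L[ℂ] Y) : Y →ₗ[ℂ] Y)))) =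
      Cardinal.lift.{v} (Module.rank ℂ
        (X ⧸ (LinearMap.range ((B ∘L A - 1 : X →L[ℂ] X) : X →ₗ[ℂ] X) ⊔ LinearMap.ker (((B ∘L A - 1) ^ n : X →L[ℂ] X) : X →ₗ[ℂ] X)))) := by
  have hA (x : X) : A (B (A x)) = A (C (A x)) := DFunLike.congr_fun h x
  rw [ContinuousLinearMap.toLinearMap_pow, ContinuousLinearMap.toLinearMap_pow]
  refine (quotientRangeSupKerPowEquiv (B ∘L A ∘L C : Y →L[ℂ] X).toLinearMap A.toLinearMap
    (fun y => ?_) (fun x => ?_) (fun y => ⟨A (C y) + y, ?_⟩)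
    (fun x => ⟨B (A x) + x, ?_⟩) n).lift_rank_eq
  · simp [hA]
  · simp [hA]
  · simp [hA]; abel
  · simp [hA]; abel
end

section
/- Let X and Y be complex Banach spaces, A : X → Y and B, C : Y → X bounded linear operators satisfying ABA = ACA. Then for every natural number n, k_n(AC − I) = k_n(BA − I), where for a bounded operator T, k_n(T) denotes the dimension (as a cardinal) of the quotient vector space (N(T) ∩ R(T^n)) / (N(T) ∩ R(T^{n+1})). -/
universe u v

/-- Linear maps that restrict to mutually inverse bijections between two submodules, and that carry
two further submodules into each other, identify the dimensions of the corresponding quotients. -/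
theorem lift_rank_quotient_comap_subtype_eq {R : Type*} {M : Type u} {N : Type v} [Ring R]
    [AddCommGroup M] [Module R M] [AddCommGroup N] [Module R N]
    {p p' : Submodule R M} {q q' : Submodule R N} (f : M →ₗ[R] N) (g : N →ₗ[R] M)
    (hf : ∀ x ∈ p, f x ∈ q) (hg : ∀ y ∈ q, g y ∈ p)
    (hf' : ∀ x ∈ p', f x ∈ q') (hg' : ∀ y ∈ q', g y ∈ p')
    (hgf : ∀ x ∈ p, g (f x) = x) (hfg : ∀ y ∈ q, f (g y) = y) :
    Cardinal.lift.{v} (Module.rank R (p ⧸ p'.comap p.subtype)) =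
      Cardinal.lift.{u} (Module.rank R (q ⧸ q'.comap q.subtype)) := by
  let e : p ≃ₗ[R] q := LinearEquiv.ofLinearMap (f.restrict hf) (g.restrict hg)
    (by ext y; exact hfg y y.2) (by ext x; exact hgf x x.2)
  refine (Submodule.Quotient.equiv _ _ e ?_).lift_rank_eq
  ext y
  rw [Submodule.mem_map]
  constructor
  · rintro ⟨x, hx, rfl⟩
    exact hf' x hx
  · intro hy
    exact ⟨e.symm y, hg' y hy, e.apply_symm_apply y⟩

section

variable {R X Y : Type*} [Ring R] [AddCommGroup X] [Module R X] [AddCommGroup Y] [Module R Y]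
  [TopologicalSpace X] [TopologicalSpace Y]
  {A : X →L[R] Y} {B C : Y →L[R] X}

theorem apply_apply_of_mem_ker (h : ∀ x, A (B (A x)) = A (C (A x))) {y : Y}
    (hy : A (C y) = y) : A (B y) = y := by
  conv_lhs => rw [← hy]
  rw [h, hy, hy]

theorem mem_ker_comp_sub_one [IsTopologicalAddGroup X] {x : X} :
    x ∈ LinearMap.ker ((B ∘L A - 1 : X →L[R] X) : X →ₗ[R] X) ↔ B (A x) = x := by
  simp [sub_eq_zero]

variable [IsTopologicalAddGroup X] [IsTopologicalAddGroup Y]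

/-- A map intertwining `S` and `T` sends the range of `S ^ n` into the range of `T ^ n`. -/
theorem apply_mem_range_pow_of_intertwine {S : X →L[R] X} {T : Y →L[R] Y} (f : X →L[R] Y)
    (hf : ∀ x, f (S x) = T (f x)) (n : ℕ) {x : X}
    (hx : x ∈ LinearMap.range ((S ^ n : X →L[R] X) : X →ₗ[R] X)) :
    f x ∈ LinearMap.range ((T ^ n : Y →L[R] Y) : Y →ₗ[R] Y) := by
  obtain ⟨z, rfl⟩ := hx
  refine ⟨f z, ?_⟩
  have hn : Function.Semiconj f S T := hf
  simp only [ContinuousLinearMap.coe_coe, FunLike.coe_pow_eq_iterate]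
  exact ((hn.iterate_right n) z).symm

/-- `A` maps `N(BA - 1) ∩ R((BA - 1) ^ n)` into `N(AC - 1) ∩ R((AC - 1) ^ n)`. -/
theorem apply_mem_ker_inf_range_pow (h : ∀ x, A (B (A x)) = A (C (A x))) (n : ℕ) {x : X}
    (hx : x ∈ LinearMap.ker ((B ∘L A - 1 : X →L[R] X) : X →ₗ[R] X) ⊓
      LinearMap.range (((B ∘L A - 1) ^ n : X →L[R] X) : X →ₗ[R] X)) :
    A x ∈ LinearMap.ker ((A ∘L C - 1 : Y →L[R] Y) : Y →ₗ[R] Y) ⊓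
      LinearMap.range (((A ∘L C - 1) ^ n : Y →L[R] Y) : Y →ₗ[R] Y) := by
  have hk := mem_ker_comp_sub_one.1 hx.1
  exact ⟨mem_ker_comp_sub_one.2 (by rw [← h, hk]),
    apply_mem_range_pow_of_intertwine A (by simp [h]) n hx.2⟩

/-- `B` maps `N(AC - 1) ∩ R((AC - 1) ^ n)` into `N(BA - 1) ∩ R((BA - 1) ^ n)`. -/
theorem apply_mem_ker_inf_range_pow' (h : ∀ x, A (B (A x)) = A (C (A x))) (n : ℕ) {y : Y}
    (hy : y ∈ LinearMap.ker ((A ∘L C - 1 : Y →L[R] Y) : Y →ₗ[R] Y) ⊓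
      LinearMap.range (((A ∘L C - 1) ^ n : Y →L[R] Y) : Y →ₗ[R] Y)) :
    B y ∈ LinearMap.ker ((B ∘L A - 1 : X →L[R] X) : X →ₗ[R] X) ⊓
      LinearMap.range (((B ∘L A - 1) ^ n : X →L[R] X) : X →ₗ[R] X) := by
  have hk := mem_ker_comp_sub_one.1 hy.1
  refine ⟨mem_ker_comp_sub_one.2 (by rw [apply_apply_of_mem_ker h hk]), ?_⟩
  have hr := apply_mem_range_pow_of_intertwine (T := B ∘L A - 1) (B ∘L A ∘L C)
    (by simp [h]) n hy.2
  rwa [ContinuousLinearMap.comp_apply, ContinuousLinearMap.comp_apply, hk] at hr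

end

theorem stmt_10
    (X : Type u) (Y : Type v)
    [NormedAddCommGroup X] [NormedSpace ℂ X] [CompleteSpace X]
    [NormedAddCommGroup Y] [NormedSpace ℂ Y] [CompleteSpace Y]
    (A : X →L[ℂ] Y) (B C : Y →L[ℂ] X)
    (h : A ∘L B ∘L A = A ∘L C ∘L A) (n : ℕ) :
    Cardinal.lift.{u} (Module.rank ℂ
        (↥(LinearMap.ker ((A ∘L C - 1 : Y →L[ℂ] Y) : Y →ₗ[ℂ] Y) ⊓ LinearMap.range (((A ∘L C - 1) ^ n : Y →L[ℂ] Y) : Y →ₗ[ℂ] Y)) ⧸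
          Submodule.comap
            (LinearMap.ker ((A ∘L C - 1 : Y →L[ℂ] Y) : Y →ₗ[ℂ] Y) ⊓ LinearMap.range (((A ∘L C - 1) ^ n : Y →L[ℂ] Y) : Y →ₗ[ℂ] Y)).subtype
            (LinearMap.ker ((A ∘L C - 1 : Y →L[ℂ] Y) : Y →ₗ[ℂ] Y) ⊓ LinearMap.range (((A ∘L C - 1) ^ (n + 1) : Y →L[ℂ] Y) : Y →ₗ[ℂ] Y)))) =
      Cardinal.lift.{v} (Module.rank ℂ
        (↥(LinearMap.ker ((B ∘L A - 1 : X →L[ℂ] X) : X →ₗ[ℂ] X) ⊓ LinearMap.range (((B ∘L A - 1) ^ n : X →L[ℂ] X) : X →ₗ[ℂ] X)) ⧸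
          Submodule.comap
            (LinearMap.ker ((B ∘L A - 1 : X →L[ℂ] X) : X →ₗ[ℂ] X) ⊓ LinearMap.range (((B ∘L A - 1) ^ n : X →L[ℂ] X) : X →ₗ[ℂ] X)).subtype
            (LinearMap.ker ((B ∘L A - 1 : X →L[ℂ] X) : X →ₗ[ℂ] X) ⊓ LinearMap.range (((B ∘L A - 1) ^ (n + 1) : X →L[ℂ] X) : X →ₗ[ℂ] X)))) := by
  have h' : ∀ x, A (B (A x)) = A (C (A x)) := fun x => DFunLike.congr_fun h x
  exact lift_rank_quotient_comap_subtype_eq (B : Y →ₗ[ℂ] X) (A : X →ₗ[ℂ] Y)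
    (fun _ hy => apply_mem_ker_inf_range_pow' h' n hy)
    (fun _ hx => apply_mem_ker_inf_range_pow h' n hx)
    (fun _ hy => apply_mem_ker_inf_range_pow' h' (n + 1) hy)
    (fun _ hx => apply_mem_ker_inf_range_pow h' (n + 1) hx)
    (fun _ hy => apply_apply_of_mem_ker h' (mem_ker_comp_sub_one.1 hy.1))
    (fun _ hx => mem_ker_comp_sub_one.1 hx.1)
end

section
/- Let X and Y be complex Banach spaces, A : X → Y and B, C : Y → X bounded linear operators satisfying ABA = ACA. Then for every nonzero complex number λ, the operator AC − λI on Y is bounded below (i.e., injective with closed range) if and only if the operator BA − λI on X is bounded below. -/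
/-- If `S` is bounded below, `U T = S V`, and `P V + Q T` is a nonzero multiple of the identity,
then `T` is bounded below. -/
theorem ContinuousLinearMap.boundedBelow_of_intertwine
    {E F : Type*} [NormedAddCommGroup E] [NormedSpace ℂ E] [CompleteSpace E]
    [NormedAddCommGroup F] [NormedSpace ℂ F] [CompleteSpace F]
    {S : F →L[ℂ] F} {T Q : E →L[ℂ] E} {U V : E →L[ℂ] F} {P : F →L[ℂ] E} {μ : ℂ}
    (hμ : μ ≠ 0) (hUV : ∀ x, U (T x) = S (V x)) (hPQ : ∀ x, μ • x = P (V x) + Q (T x))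
    (hS : Function.Injective S ∧
      IsClosed ((LinearMap.range S.toLinearMap : Submodule ℂ F) : Set F)) :
    Function.Injective T ∧
      IsClosed ((LinearMap.range T.toLinearMap : Submodule ℂ E) : Set E) := by
  obtain ⟨K, hK⟩ := S.antilipschitz_of_injective_of_isClosed_range hS.1 hS.2
  have hT : AntilipschitzWith (‖μ‖₊⁻¹ * (‖P‖₊ * (K * ‖U‖₊) + ‖Q‖₊)) T := by
    refine T.antilipschitz_of_bound fun x => ?_
    have hV : ‖V x‖ ≤ K * (‖U‖ * ‖T x‖) :=
      (S.bound_of_antilipschitz hK (V x)).trans <| by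
        rw [← hUV]
        gcongr
        exact U.le_opNorm _
    have hx : ‖μ‖ * ‖x‖ ≤ (‖P‖ * (K * ‖U‖) + ‖Q‖) * ‖T x‖ :=
      calc ‖μ‖ * ‖x‖ = ‖P (V x) + Q (T x)‖ := by rw [← norm_smul, hPQ]
        _ ≤ ‖P‖ * ‖V x‖ + ‖Q‖ * ‖T x‖ :=
          norm_add_le_of_le (P.le_opNorm _) (Q.le_opNorm _)
        _ ≤ ‖P‖ * (K * (‖U‖ * ‖T x‖)) + ‖Q‖ * ‖T x‖ := by gcongr
        _ = _ := by ring
    push_cast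
    rw [mul_assoc]
    exact (le_inv_mul_iff₀ (norm_pos_iff.mpr hμ)).mpr hx
  exact ⟨hT.injective, hT.isClosed_range T.uniformContinuous⟩

theorem stmt_15
    (X Y : Type*) [NormedAddCommGroup X] [NormedSpace ℂ X] [CompleteSpace X]
    [NormedAddCommGroup Y] [NormedSpace ℂ Y] [CompleteSpace Y]
    (A : X →L[ℂ] Y) (B C : Y →L[ℂ] X)
    (h : A ∘L B ∘L A = A ∘L C ∘L A) (lam : ℂ) (hlam : lam ≠ 0) :
    (Function.Injective ⇑(A ∘L C - lam • (1 : Y →L[ℂ] Y)) ∧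
        IsClosed ((LinearMap.range (A ∘L C - lam • (1 : Y →L[ℂ] Y)).toLinearMap : Submodule ℂ Y) : Set Y)) ↔
      (Function.Injective ⇑(B ∘L A - lam • (1 : X →L[ℂ] X)) ∧
        IsClosed ((LinearMap.range (B ∘L A - lam • (1 : X →L[ℂ] X)).toLinearMap : Submodule ℂ X) : Set X)) := by
  have hABA (x : X) : A (B (A x)) = A (C (A x)) := DFunLike.congr_fun h x
  constructor
  · refine ContinuousLinearMap.boundedBelow_of_intertwine (U := A) (V := A) (P := B) (Q := -1)
      hlam (fun x => ?_) (fun x => ?_)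
    · simp [hABA]
    · simp
  · refine ContinuousLinearMap.boundedBelow_of_intertwine (U := B ∘L A ∘L C) (V := B ∘L A ∘L C)
      (P := A) (Q := -(lam • 1 + A ∘L C)) (pow_ne_zero 2 hlam) (fun y => ?_) (fun y => ?_)
    · simp [hABA]
    · simp only [ContinuousLinearMap.comp_apply, sub_apply, neg_apply, add_apply, smul_apply,
        one_apply_eq_self, map_sub, map_smul, hABA]
      module
end

section
/- Let X and Y be complex Banach spaces, A : X → Y and B, C : Y → X bounded linear operators satisfying ABA = ACA. Then for every nonzero complex number λ, the operator AC − λI on Y is lower semi-Fredholm (i.e., the quotient Y / R(AC − λI) is finite-dimensional) if and only if the operator BA − λI on X is lower semi-Fredholm (i.e., X / R(BA − λI) is finite-dimensional). -/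
/-- If `A B A = A C A` and `μ ≠ 0`, then `A` induces an isomorphism between the cokernels of
`B A - μ` and `A C - μ`. -/
theorem nonempty_coker_equiv_of_comp_eq {K X Y : Type*} [Field K] [AddCommGroup X] [Module K X]
    [AddCommGroup Y] [Module K Y] (A : X →ₗ[K] Y) (B C : Y →ₗ[K] X)
    (h : ∀ x, A (B (A x)) = A (C (A x))) {μ : K} (hμ : μ ≠ 0)
    (S : X →ₗ[K] X) (T : Y →ₗ[K] Y)
    (hS : ∀ x, S x = B (A x) - μ • x) (hT : ∀ y, T y = A (C y) - μ • y) :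
    Nonempty ((X ⧸ LinearMap.range S) ≃ₗ[K] (Y ⧸ LinearMap.range T)) := by
  have intertwine : ∀ x, A (S x) = T (A x) := fun x => by simp [hS, hT, h]
  have hle : LinearMap.range S ≤ (LinearMap.range T).comap A := by
    rintro _ ⟨x, rfl⟩
    exact ⟨A x, (intertwine x).symm⟩
  refine ⟨LinearEquiv.ofBijective (Submodule.mapQ _ _ A hle) ⟨?_, ?_⟩⟩
  · rw [injective_iff_map_eq_zero]
    intro q hq
    obtain ⟨x, rfl⟩ := Submodule.Quotient.mk_surjective _ q
    rw [Submodule.mapQ_apply, Submodule.Quotient.mk_eq_zero] at hq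
    rw [Submodule.Quotient.mk_eq_zero]
    obtain ⟨y, hy⟩ := hq
    obtain ⟨z, rfl⟩ : ∃ z, A z = y := by
      refine ⟨μ⁻¹ • (C y - x), ?_⟩
      rw [map_smul, map_sub, ← hy, hT, sub_sub_cancel, inv_smul_smul₀ hμ]
    have hker : A (x - S z) = 0 := by rw [map_sub, intertwine, hy, sub_self]
    refine ⟨z - μ⁻¹ • (x - S z), ?_⟩
    rw [map_sub, map_smul, hS (x - S z), hker, map_zero, zero_sub, smul_neg,
      inv_smul_smul₀ hμ]
    abel
  · intro q
    obtain ⟨y, rfl⟩ := Submodule.Quotient.mk_surjective _ q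
    refine ⟨Submodule.Quotient.mk (μ⁻¹ • C y), ?_⟩
    rw [Submodule.mapQ_apply, Submodule.Quotient.eq]
    refine ⟨μ⁻¹ • y, ?_⟩
    rw [map_smul, hT, smul_sub, inv_smul_smul₀ hμ, map_smul]

theorem stmt_16
    (X Y : Type*) [NormedAddCommGroup X] [NormedSpace ℂ X] [CompleteSpace X]
    [NormedAddCommGroup Y] [NormedSpace ℂ Y] [CompleteSpace Y]
    (A : X →L[ℂ] Y) (B C : Y →L[ℂ] X)
    (h : A ∘L B ∘L A = A ∘L C ∘L A) (lam : ℂ) (hlam : lam ≠ 0) :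
    FiniteDimensional ℂ (Y ⧸ LinearMap.range (A ∘L C - lam • (1 : Y →L[ℂ] Y)).toLinearMap) ↔
      FiniteDimensional ℂ (X ⧸ LinearMap.range (B ∘L A - lam • (1 : X →L[ℂ] X)).toLinearMap) := by
  obtain ⟨e⟩ := nonempty_coker_equiv_of_comp_eq A.toLinearMap B.toLinearMap C.toLinearMap
    (fun x => DFunLike.congr_fun h x) hlam
    (B ∘L A - lam • (1 : X →L[ℂ] X)).toLinearMap (A ∘L C - lam • (1 : Y →L[ℂ] Y)).toLinearMap
    (fun _ => rfl) (fun _ => rfl)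
  exact ⟨fun _ => Module.Finite.equiv e.symm, fun _ => Module.Finite.equiv e⟩
end

section
/- Let X and Y be complex Banach spaces, A : X → Y and B, C : Y → X bounded linear operators satisfying ABA = ACA. Then for every nonzero complex number λ, the operator AC − λI on Y is upper semi-Fredholm (i.e., its kernel is finite-dimensional and its range is closed) if and only if the operator BA − λI on X is upper semi-Fredholm. -/
/-- A bounded operator between Banach spaces has finite-dimensional kernel and closed range if and
only if it becomes bounded below after adjoining finitely many continuous functionals. -/
theorem finiteDimensional_ker_and_isClosed_range_iff_exists_bound
    {E F : Type*} [NormedAddCommGroup E] [NormedSpace ℂ E] [CompleteSpace E]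
    [NormedAddCommGroup F] [NormedSpace ℂ F] [CompleteSpace F] (T : E →L[ℂ] F) :
    (FiniteDimensional ℂ (LinearMap.ker (T : E →ₗ[ℂ] F)) ∧
        IsClosed ((LinearMap.range (T : E →ₗ[ℂ] F) : Submodule ℂ F) : Set F)) ↔
      ∃ (n : ℕ) (P : E →L[ℂ] (Fin n → ℂ)) (K : NNReal), ∀ x, ‖x‖ ≤ K * (‖T x‖ + ‖P x‖) := by
  constructor
  · rintro ⟨hker, hran⟩
    obtain ⟨p, hp⟩ :=
      Submodule.ClosedComplemented.of_finiteDimensional (LinearMap.ker (T : E →ₗ[ℂ] F))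
    let e := (Module.finBasis ℂ (LinearMap.ker (T : E →ₗ[ℂ] F))).equivFunL
    let P := e.toContinuousLinearMap ∘L p
    have hinj : Function.Injective (T.prod P) := by
      rw [injective_iff_map_eq_zero]
      intro x hx
      have hTx : T x = 0 := congrArg Prod.fst hx
      have hPx : e (p x) = 0 := congrArg Prod.snd hx
      have hpx : p x = 0 := by simpa using hPx
      have := hp ⟨x, hTx⟩
      rw [hpx] at this
      exact (congrArg Subtype.val this).symm
    have hrange : Set.range (T.prod P) = Set.range T ×ˢ Set.univ := by
      ext ⟨y, v⟩
      simp only [Set.mem_range, Set.mem_prod, Set.mem_univ, and_true]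
      constructor
      · rintro ⟨x, hx⟩
        exact ⟨x, congrArg Prod.fst hx⟩
      · rintro ⟨x, rfl⟩
        have hT (k : LinearMap.ker (T : E →ₗ[ℂ] F)) : T k = 0 := k.2
        refine ⟨x - p x + e.symm v, Prod.ext ?_ ?_⟩
        · simp [hT]
        · simp [P, hp]
    obtain ⟨K, hK⟩ := (T.prod P).antilipschitz_of_injective_of_isClosed_range hinj
      (hrange ▸ IsClosed.prod hran isClosed_univ)
    refine ⟨_, P, K, fun x ↦ ((T.prod P).bound_of_antilipschitz hK x).trans ?_⟩
    gcongr
    exact max_le_add_of_nonneg (norm_nonneg _) (norm_nonneg _)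
  · rintro ⟨n, P, K, hK⟩
    constructor
    · refine FiniteDimensional.of_injective
        ((P : E →ₗ[ℂ] (Fin n → ℂ)) ∘ₗ (LinearMap.ker (T : E →ₗ[ℂ] F)).subtype) ?_
      rw [injective_iff_map_eq_zero]
      rintro ⟨x, hx⟩ hPx
      have hTx : T x = 0 := hx
      replace hPx : P x = 0 := hPx
      have := hK x
      rw [hTx, hPx] at this
      simpa using this
    · have hcofg : (LinearMap.ker (P : E →ₗ[ℂ] (Fin n → ℂ))).CoFG :=
        Module.Finite.equiv (P : E →ₗ[ℂ] (Fin n → ℂ)).quotKerEquivRange.symm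
      have : CompleteSpace (LinearMap.ker (P : E →ₗ[ℂ] (Fin n → ℂ))) :=
        P.isClosed_ker.completeSpace_coe
      refine LinearMap.isClosed_range_of_isClosed_map_of_finiteDimensional_quotient
        (s := LinearMap.ker (P : E →ₗ[ℂ] (Fin n → ℂ))) ?_
      let R := T ∘L (LinearMap.ker (P : E →ₗ[ℂ] (Fin n → ℂ))).subtypeL
      have hR : AntilipschitzWith K R := R.antilipschitz_of_bound fun x ↦ by
        have hPx : P x = 0 := x.2
        simpa [R, hPx] using hK x
      convert hR.isClosed_range R.uniformContinuous
      ext y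
      simp [R]

/-- The property of having finite-dimensional kernel and closed range passes from `T` to `S`
along `T ∘ P = P ∘ S`, provided that `Q ∘ P` is a nonzero scalar modulo left multiples of `S`. -/
theorem finiteDimensional_ker_and_isClosed_range_of_intertwining
    {E F : Type*} [NormedAddCommGroup E] [NormedSpace ℂ E] [CompleteSpace E]
    [NormedAddCommGroup F] [NormedSpace ℂ F] [CompleteSpace F]
    {S : E →L[ℂ] E} {T : F →L[ℂ] F} {P : E →L[ℂ] F} {Q : F →L[ℂ] E} {R : E →L[ℂ] E} {μ : ℂ}
    (hμ : μ ≠ 0) (hTP : ∀ x, T (P x) = P (S x)) (hQP : ∀ x, μ • x = Q (P x) + R (S x))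
    (hT : FiniteDimensional ℂ (LinearMap.ker (T : F →ₗ[ℂ] F)) ∧
      IsClosed ((LinearMap.range (T : F →ₗ[ℂ] F) : Submodule ℂ F) : Set F)) :
    FiniteDimensional ℂ (LinearMap.ker (S : E →ₗ[ℂ] E)) ∧
      IsClosed ((LinearMap.range (S : E →ₗ[ℂ] E) : Submodule ℂ E) : Set E) := by
  rw [finiteDimensional_ker_and_isClosed_range_iff_exists_bound] at hT ⊢
  obtain ⟨n, V, K, hK⟩ := hT
  refine ⟨n, V ∘L P, ‖μ‖₊⁻¹ * (‖Q‖₊ * K * (‖P‖₊ + 1) + ‖R‖₊), fun x ↦ ?_⟩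
  have hμx : ‖μ‖ * ‖x‖ ≤ (‖Q‖ * K * (‖P‖ + 1) + ‖R‖) * (‖S x‖ + ‖V (P x)‖) :=
    calc ‖μ‖ * ‖x‖ = ‖Q (P x) + R (S x)‖ := by rw [← norm_smul, hQP]
      _ ≤ ‖Q‖ * ‖P x‖ + ‖R‖ * ‖S x‖ :=
        (norm_add_le _ _).trans (add_le_add (Q.le_opNorm _) (R.le_opNorm _))
      _ ≤ ‖Q‖ * (K * (‖P‖ * ‖S x‖ + ‖V (P x)‖)) + ‖R‖ * ‖S x‖ := by
        gcongr
        refine (hK (P x)).trans ?_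
        rw [hTP]
        gcongr
        exact P.le_opNorm _
      _ ≤ ‖Q‖ * (K * ((‖P‖ + 1) * (‖S x‖ + ‖V (P x)‖))) + ‖R‖ * (‖S x‖ + ‖V (P x)‖) := by
        gcongr
        · nlinarith [mul_nonneg (norm_nonneg P) (norm_nonneg (V (P x))), norm_nonneg (S x)]
        · exact le_add_of_nonneg_right (norm_nonneg _)
      _ = _ := by ring
  have hpos : 0 < ‖μ‖ := norm_pos_iff.mpr hμ
  push_cast
  rw [mul_assoc, ← div_eq_inv_mul, le_div_iff₀' hpos]
  exact hμx


theorem stmt_17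
    (X Y : Type*) [NormedAddCommGroup X] [NormedSpace ℂ X] [CompleteSpace X]
    [NormedAddCommGroup Y] [NormedSpace ℂ Y] [CompleteSpace Y]
    (A : X →L[ℂ] Y) (B C : Y →L[ℂ] X)
    (h : A ∘L B ∘L A = A ∘L C ∘L A) (lam : ℂ) (hlam : lam ≠ 0) :
    (FiniteDimensional ℂ (LinearMap.ker ((A ∘L C - lam • (1 : Y →L[ℂ] Y) : Y →L[ℂ] Y) : Y →ₗ[ℂ] Y)) ∧
        IsClosed ((LinearMap.range ((A ∘L C - lam • (1 : Y →L[ℂ] Y) : Y →L[ℂ] Y) : Y →ₗ[ℂ] Y) : Submodule ℂ Y) : Set Y)) ↔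
      (FiniteDimensional ℂ (LinearMap.ker ((B ∘L A - lam • (1 : X →L[ℂ] X) : X →L[ℂ] X) : X →ₗ[ℂ] X)) ∧
        IsClosed ((LinearMap.range ((B ∘L A - lam • (1 : X →L[ℂ] X) : X →L[ℂ] X) : X →ₗ[ℂ] X) : Submodule ℂ X) : Set X)) := by
  have hABA (x : X) : A (B (A x)) = A (C (A x)) := congrArg (fun L : X →L[ℂ] Y ↦ L x) h
  have hsq : lam ^ 2 ≠ 0 := pow_ne_zero 2 hlam
  constructor
  · refine finiteDimensional_ker_and_isClosed_range_of_intertwining (P := A ∘L B ∘L A) (Q := B)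
      (R := -(B ∘L A + lam • (1 : X →L[ℂ] X))) hsq (fun x ↦ ?_) fun x ↦ ?_
    · simp [hABA]
    · simp only [ContinuousLinearMap.comp_apply, sub_apply,
        add_apply, neg_apply,
        smul_apply, one_apply_eq_self, map_sub, map_smul]
      module
  · refine finiteDimensional_ker_and_isClosed_range_of_intertwining (P := B ∘L A ∘L C) (Q := A)
      (R := -(A ∘L C + lam • (1 : Y →L[ℂ] Y))) hsq (fun y ↦ ?_) fun y ↦ ?_
    · simp [hABA]
    · simp only [ContinuousLinearMap.comp_apply, sub_apply,
        add_apply, neg_apply, hABA,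
        smul_apply, one_apply_eq_self, map_sub, map_smul]
      module
end

section
/- Let X and Y be complex Banach spaces, A : X → Y and B, C : Y → X bounded linear operators satisfying ABA = ACA. Then for every nonzero complex number λ, the operator AC − λI on Y is semi-regular (i.e., its range is closed and its kernel is contained in the range of every power (AC − λI)^n) if and only if the operator BA − λI on X is semi-regular. -/
/-- Semi-regularity passes from `S` to `T` when `U` and `V` intertwine `S` and `T` and
`V U = (T + c)²` for some nonzero scalar `c`. -/
theorem semiregular_of_intertwining {𝕜 X Y : Type*} [NontriviallyNormedField 𝕜]
    [NormedAddCommGroup X] [NormedSpace 𝕜 X] [NormedAddCommGroup Y] [NormedSpace 𝕜 Y]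
    {S : Y →L[𝕜] Y} {T : X →L[𝕜] X} {U : X →L[𝕜] Y} {V : Y →L[𝕜] X} {c : 𝕜} (hc : c ≠ 0)
    (hU : ∀ x, S (U x) = U (T x)) (hV : ∀ y, T (V y) = V (S y))
    (hVU : ∀ x, V (U x) = T (T x) + (2 * c) • T x + (c * c) • x)
    (hS : IsClosed ((LinearMap.range (S : Y →ₗ[𝕜] Y) : Submodule 𝕜 Y) : Set Y) ∧
      ∀ n : ℕ, LinearMap.ker (S : Y →ₗ[𝕜] Y) ≤
        LinearMap.range ((S ^ n : Y →L[𝕜] Y) : Y →ₗ[𝕜] Y)) :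
    IsClosed ((LinearMap.range (T : X →ₗ[𝕜] X) : Submodule 𝕜 X) : Set X) ∧
      ∀ n : ℕ, LinearMap.ker (T : X →ₗ[𝕜] X) ≤
        LinearMap.range ((T ^ n : X →L[𝕜] X) : X →ₗ[𝕜] X) := by
  have hcc : c * c ≠ 0 := mul_ne_zero hc hc
  refine ⟨?_, fun n x hx => ?_⟩
  · convert hS.1.preimage U.continuous using 1
    ext x
    constructor
    · rintro ⟨z, rfl⟩
      exact ⟨U z, hU z⟩
    · rintro ⟨y, hy⟩
      have hy' : S y = U x := hy
      refine (Submodule.smul_mem_iff _ hcc).1 ⟨V y - T x - (2 * c) • x, ?_⟩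
      change T (V y - T x - (2 * c) • x) = (c * c) • x
      rw [map_sub, map_sub, map_smul, hV, hy', hVU]
      abel
  · have hx' : T x = 0 := hx
    have hUx : S (U x) = 0 := by rw [hU, hx', map_zero]
    obtain ⟨y, hy⟩ := hS.2 n hUx
    have hy' : (S ^ n) y = U x := hy
    have hpow : ∀ (m : ℕ) (z : Y), (T ^ m) (V z) = V ((S ^ m) z) := by
      intro m
      induction m with
      | zero => intro z; rfl
      | succ m ih =>
        intro z
        rw [pow_succ, pow_succ, mul_apply_eq_comp, mul_apply_eq_comp,
          hV, ih]
    refine (Submodule.smul_mem_iff _ hcc).1 ⟨V y, ?_⟩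
    change (T ^ n) (V y) = (c * c) • x
    rw [hpow, hy', hVU, hx']
    simp

theorem stmt_18
    (X Y : Type*) [NormedAddCommGroup X] [NormedSpace ℂ X] [CompleteSpace X]
    [NormedAddCommGroup Y] [NormedSpace ℂ Y] [CompleteSpace Y]
    (A : X →L[ℂ] Y) (B C : Y →L[ℂ] X)
    (h : A ∘L B ∘L A = A ∘L C ∘L A) (lam : ℂ) (hlam : lam ≠ 0) :
    (IsClosed ((LinearMap.range ((A ∘L C - lam • (1 : Y →L[ℂ] Y) : Y →L[ℂ] Y) : Y →ₗ[ℂ] Y) : Submodule ℂ Y) : Set Y) ∧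
        ∀ n : ℕ, LinearMap.ker ((A ∘L C - lam • (1 : Y →L[ℂ] Y) : Y →L[ℂ] Y) : Y →ₗ[ℂ] Y) ≤
          LinearMap.range (((A ∘L C - lam • (1 : Y →L[ℂ] Y)) ^ n : Y →L[ℂ] Y) : Y →ₗ[ℂ] Y)) ↔
      (IsClosed ((LinearMap.range ((B ∘L A - lam • (1 : X →L[ℂ] X) : X →L[ℂ] X) : X →ₗ[ℂ] X) : Submodule ℂ X) : Set X) ∧
        ∀ n : ℕ, LinearMap.ker ((B ∘L A - lam • (1 : X →L[ℂ] X) : X →L[ℂ] X) : X →ₗ[ℂ] X) ≤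
          LinearMap.range (((B ∘L A - lam • (1 : X →L[ℂ] X)) ^ n : X →L[ℂ] X) : X →ₗ[ℂ] X)) := by
  have hA : ∀ x, A (B (A x)) = A (C (A x)) := fun x => DFunLike.congr_fun h x
  have hU : ∀ x, (A ∘L C - lam • (1 : Y →L[ℂ] Y)) (A x) =
      A ((B ∘L A - lam • (1 : X →L[ℂ] X)) x) := fun x => by simp [hA]
  have hV : ∀ y, (B ∘L A - lam • (1 : X →L[ℂ] X)) ((B ∘L A ∘L C) y) =
      (B ∘L A ∘L C) ((A ∘L C - lam • (1 : Y →L[ℂ] Y)) y) := fun y => by simp [hA]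
  constructor
  · refine semiregular_of_intertwining hlam hU hV fun x => ?_
    simp [hA]
    module
  · refine semiregular_of_intertwining hlam hV hU fun y => ?_
    simp [hA]
    module
end

section
/- Let X and Y be complex Banach spaces, A : X → Y and B, C : Y → X bounded linear operators satisfying ABA = ACA. Then for every nonzero complex number λ, the operator AC − λI on Y is right Drazin invertible (i.e., there exists a natural number d such that R((AC − λI)^d) = R((AC − λI)^{d+1}) and R((AC − λI)^{d+1}) is closed) if and only if the operator BA − λI on X is right Drazin invertible. -/
open Polynomial in
/-- If `A` and `W` intertwine `T` and `S`, and `W A = (T + lam)²` with `lam ≠ 0`, then the range of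
`T ^ n` is the preimage under `A` of the range of `S ^ n`. -/
theorem range_pow_eq_comap_of_intertwine {𝕜 E F : Type*} [NontriviallyNormedField 𝕜]
    [NormedAddCommGroup E] [NormedSpace 𝕜 E] [NormedAddCommGroup F] [NormedSpace 𝕜 F]
    {S : F →L[𝕜] F} {T : E →L[𝕜] E} {A : E →L[𝕜] F} {W : F →L[𝕜] E} {lam : 𝕜} (hlam : lam ≠ 0)
    (hA : ∀ x, A (T x) = S (A x)) (hW : ∀ y, W (S y) = T (W y))
    (hWA : ∀ x, W (A x) = ((T + algebraMap 𝕜 (E →L[𝕜] E) lam) ^ 2) x) (n : ℕ) :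
    LinearMap.range ((T ^ n : E →L[𝕜] E) : E →ₗ[𝕜] E) =
      (LinearMap.range ((S ^ n : F →L[𝕜] F) : F →ₗ[𝕜] F)).comap (A : E →ₗ[𝕜] F) := by
  have hAn : ∀ x, A ((T ^ n) x) = (S ^ n) (A x) := by
    intro x
    simpa using (show Function.Semiconj A T S from hA).iterate_right n x
  have hWn : ∀ y, W ((S ^ n) y) = (T ^ n) (W y) := by
    intro y
    simpa using (show Function.Semiconj W S T from hW).iterate_right n y
  ext x
  simp only [LinearMap.mem_range, Submodule.mem_comap, ContinuousLinearMap.coe_coe]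
  constructor
  · rintro ⟨z, rfl⟩
    exact ⟨A z, (hAn z).symm⟩
  · rintro ⟨y, hy⟩
    have hcop : IsCoprime ((X + C lam : 𝕜[X]) ^ 2) (X ^ n) := by
      refine IsCoprime.pow ⟨C lam⁻¹, -C lam⁻¹, ?_⟩
      have hC : (C lam⁻¹ * C lam : 𝕜[X]) = 1 := by rw [← C_mul, inv_mul_cancel₀ hlam, C_1]
      linear_combination hC
    obtain ⟨u, v, huv⟩ := hcop
    have key : (X ^ n : 𝕜[X]) * v + u * (X + C lam) ^ 2 = 1 := by
      linear_combination huv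
    have hT := congrArg (fun p : 𝕜[X] => aeval T p x) key
    have hcomm : aeval T u * T ^ n = T ^ n * aeval T u := by
      have := congrArg (aeval T) (mul_comm u (X ^ n))
      simpa using this
    simp only [map_add, map_mul, map_pow, aeval_X, aeval_C, map_one] at hT
    refine ⟨aeval T v x + aeval T u (W y), ?_⟩
    have hx : (T ^ n) (aeval T u (W y)) = aeval T u (W (A x)) := by
      rw [← hy, hWn]
      exact (DFunLike.congr_fun hcomm (W y)).symm
    rw [map_add, hx, hWA]
    exact hT

/-- A pair of intertwining operators as in `range_pow_eq_comap_of_intertwine` transfers right Drazin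
invertibility from `S` to `T`. -/
theorem rightDrazin_of_intertwine {𝕜 E F : Type*} [NontriviallyNormedField 𝕜]
    [NormedAddCommGroup E] [NormedSpace 𝕜 E] [NormedAddCommGroup F] [NormedSpace 𝕜 F]
    {S : F →L[𝕜] F} {T : E →L[𝕜] E} {A : E →L[𝕜] F} {W : F →L[𝕜] E} {lam : 𝕜} (hlam : lam ≠ 0)
    (hA : ∀ x, A (T x) = S (A x)) (hW : ∀ y, W (S y) = T (W y))
    (hWA : ∀ x, W (A x) = ((T + algebraMap 𝕜 (E →L[𝕜] E) lam) ^ 2) x)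
    (hS : ∃ d : ℕ, LinearMap.range ((S ^ d : F →L[𝕜] F) : F →ₗ[𝕜] F) =
        LinearMap.range ((S ^ (d + 1) : F →L[𝕜] F) : F →ₗ[𝕜] F) ∧
      IsClosed ((LinearMap.range ((S ^ (d + 1) : F →L[𝕜] F) : F →ₗ[𝕜] F) : Submodule 𝕜 F) :
        Set F)) :
    ∃ d : ℕ, LinearMap.range ((T ^ d : E →L[𝕜] E) : E →ₗ[𝕜] E) =
        LinearMap.range ((T ^ (d + 1) : E →L[𝕜] E) : E →ₗ[𝕜] E) ∧
      IsClosed ((LinearMap.range ((T ^ (d + 1) : E →L[𝕜] E) : E →ₗ[𝕜] E) : Submodule 𝕜 E) :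
        Set E) := by
  obtain ⟨d, hd, hcl⟩ := hS
  refine ⟨d, ?_, ?_⟩
  · rw [range_pow_eq_comap_of_intertwine hlam hA hW hWA,
      range_pow_eq_comap_of_intertwine hlam hA hW hWA, hd]
  · rw [range_pow_eq_comap_of_intertwine hlam hA hW hWA]
    exact hcl.preimage A.continuous


theorem stmt_19
    (X Y : Type*) [NormedAddCommGroup X] [NormedSpace ℂ X] [CompleteSpace X]
    [NormedAddCommGroup Y] [NormedSpace ℂ Y] [CompleteSpace Y]
    (A : X →L[ℂ] Y) (B C : Y →L[ℂ] X)
    (h : A ∘L B ∘L A = A ∘L C ∘L A) (lam : ℂ) (hlam : lam ≠ 0) :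
    (∃ d : ℕ, LinearMap.range (((A ∘L C - lam • (1 : Y →L[ℂ] Y)) ^ d : Y →L[ℂ] Y) : Y →ₗ[ℂ] Y) =
        LinearMap.range (((A ∘L C - lam • (1 : Y →L[ℂ] Y)) ^ (d + 1) : Y →L[ℂ] Y) : Y →ₗ[ℂ] Y) ∧
        IsClosed ((LinearMap.range (((A ∘L C - lam • (1 : Y →L[ℂ] Y)) ^ (d + 1) : Y →L[ℂ] Y) : Y →ₗ[ℂ] Y) :
          Submodule ℂ Y) : Set Y)) ↔
      (∃ d : ℕ, LinearMap.range (((B ∘L A - lam • (1 : X →L[ℂ] X)) ^ d : X →L[ℂ] X) : X →ₗ[ℂ] X) =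
        LinearMap.range (((B ∘L A - lam • (1 : X →L[ℂ] X)) ^ (d + 1) : X →L[ℂ] X) : X →ₗ[ℂ] X) ∧
        IsClosed ((LinearMap.range (((B ∘L A - lam • (1 : X →L[ℂ] X)) ^ (d + 1) : X →L[ℂ] X) : X →ₗ[ℂ] X) :
          Submodule ℂ X) : Set X)) := by
  have h' : ∀ x, A (B (A x)) = A (C (A x)) := fun x => DFunLike.congr_fun h x
  have hA : ∀ x, A ((B ∘L A - lam • (1 : X →L[ℂ] X)) x) =
      (A ∘L C - lam • (1 : Y →L[ℂ] Y)) (A x) := by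
    intro x
    simp [h']
  have hW : ∀ y, (B ∘L A ∘L C) ((A ∘L C - lam • (1 : Y →L[ℂ] Y)) y) =
      (B ∘L A - lam • (1 : X →L[ℂ] X)) ((B ∘L A ∘L C) y) := by
    intro y
    simp [h']
  constructor
  · refine rightDrazin_of_intertwine hlam hA hW fun x => ?_
    simp [Algebra.algebraMap_eq_smul_one, pow_two, h']
  · refine rightDrazin_of_intertwine hlam hW hA fun y => ?_
    simp [Algebra.algebraMap_eq_smul_one, pow_two, h']
end
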